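/- For every initial state x(0) ∈ S^N, the sequence defined by x(t+1) = T(x(t)) is eventually constant: there exists t₀ such that x(t) = x(t₀) for all t ≥ t₀ and x(t₀) is a fixed point of T. In other words, the complex-valued multistate recurrent correlation neural network with synchronous update always settles at an equilibrium. -/

import Mathlib

open scoped Classical

/-- The argument of a complex number taken in `[0, 2π)`. -/
noncomputable def arg2pi (z : ℂ) : ℝ :=
  if Complex.arg z < 0 then Complex.arg z + 2 * Real.pi else Complex.arg z

/-- The domain `D` of the complex-valued multistate signum function: nonzero complex
numbers whose argument (in `[0, 2π)`) differs from `(2k-1)·Δθ` for all `k = 1,…,K`,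
where `Δθ = π/K`. -/
def Dset (K : ℕ) : Set ℂ :=
  {z | z ≠ 0 ∧ ∀ k : ℕ, 1 ≤ k → k ≤ K → arg2pi z ≠ (2 * (k : ℝ) - 1) * (Real.pi / K)}

/-- The set `S = {e^{2kΔθ·i} : k = 0,…,K-1}` of `K`-th roots of unity, `Δθ = π/K`. -/
def Sset (K : ℕ) : Set ℂ :=
  {s | ∃ k : ℕ, k < K ∧ s = Complex.exp ((2 * (k : ℝ) * (Real.pi / K) : ℝ) * Complex.I)}

/-- `csgn` is a complex-valued multistate signum function with resolution factor `K`: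
for every `z ∈ D`, `csgn z` is the element `s ∈ S` such that the argument of
`z · conj s` lies in the open interval `(-Δθ, Δθ)` modulo `2π`. -/
def IsCsgn (K : ℕ) (csgn : ℂ → ℂ) : Prop :=
  ∀ z ∈ Dset K, csgn z ∈ Sset K ∧
    Complex.arg (z * (starRingEnd ℂ) (csgn z)) ∈ Set.Ioo (-(Real.pi / K)) (Real.pi / K)

/-- Correlation `Σ_i Re(conj(u_i^ξ)·x_i)` of a state with the `ξ`-th fundamental memory. -/
noncomputable def cOverlap {N P : ℕ} (u : Fin P → Fin N → ℂ) (x : Fin N → ℂ) (ξ : Fin P) : ℝ :=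
  ∑ i, ((starRingEnd ℂ) (u ξ i) * x i).re

/-- Activation potential `h_i(x) = Σ_ξ w_ξ(x)·u_i^ξ` with `w_ξ(x) = f(cOverlap u x ξ)`. -/
noncomputable def cPot {N P : ℕ} (f : ℝ → ℝ) (u : Fin P → Fin N → ℂ) (x : Fin N → ℂ)
    (i : Fin N) : ℂ :=
  ∑ ξ, (f (cOverlap u x ξ) : ℂ) * u ξ i

/-- Energy of the complex-valued recurrent correlation neural network. -/
noncomputable def cEnergy {N P : ℕ} (F : ℝ → ℝ) (u : Fin P → Fin N → ℂ) (x : Fin N → ℂ) : ℝ :=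
  -∑ ξ, F (cOverlap u x ξ)

/-- Synchronous update of the complex-valued multistate RCNN. -/
noncomputable def cUpd (K : ℕ) (csgn : ℂ → ℂ) {N P : ℕ} (f : ℝ → ℝ)
    (u : Fin P → Fin N → ℂ) (x : Fin N → ℂ) : Fin N → ℂ :=
  fun i => if cPot f u x i ∈ Dset K then csgn (cPot f u x i) else x i

theorem aux_conv (f F : ℝ → ℝ) (hmono : Monotone f)
    (hF : ∀ t : ℝ, HasDerivAt F (f t) t) (a b : ℝ) : f a * (b - a) ≤ F b - F a := by
  have hc : Continuous F := continuous_iff_continuousAt.2 fun t => (hF t).continuousAt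
  rcases lt_trichotomy a b with h | h | h
  · obtain ⟨c, hc1, hc2⟩ := exists_hasDerivAt_eq_slope F f h hc.continuousOn (fun t _ => hF t)
    have hba : 0 < b - a := by linarith
    rw [eq_div_iff hba.ne'] at hc2
    rw [← hc2]
    exact mul_le_mul_of_nonneg_right (hmono hc1.1.le) hba.le
  · subst h; simp
  · obtain ⟨c, hc1, hc2⟩ := exists_hasDerivAt_eq_slope F f h hc.continuousOn (fun t _ => hF t)
    have hba : 0 < a - b := by linarith
    rw [eq_div_iff hba.ne'] at hc2
    have := mul_le_mul_of_nonneg_right (hmono hc1.2.le) hba.le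
    nlinarith

theorem aux_trig (φ α : ℝ) : Real.cos φ - Real.cos (φ - 2 * α)
    = 2 * (Real.sin α * Real.sin (α - φ)) := by
  rw [Real.cos_sub, Real.sin_sub, Real.cos_two_mul, Real.sin_two_mul]
  have := Real.sin_sq_add_cos_sq α
  linear_combination (-2 * Real.cos φ) * this

theorem aux_max (K : ℕ) (hK : 1 < K) (z s t : ℂ) (hz : z ≠ 0) (hs : s ∈ Sset K) (ht : t ∈ Sset K)
    (hst : t ≠ s)
    (harg : Complex.arg (z * (starRingEnd ℂ) s) ∈ Set.Ioo (-(Real.pi / K)) (Real.pi / K)) :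
    (z * (starRingEnd ℂ) t).re < (z * (starRingEnd ℂ) s).re := by
  obtain ⟨k, hk, rfl⟩ := hs
  obtain ⟨l, hl, rfl⟩ := ht
  have hkl : l ≠ k := by rintro rfl; exact hst rfl
  set d : ℝ := Real.pi / K with hd
  have hK0 : (0 : ℝ) < K := by positivity
  have hd0 : 0 < d := by have := Real.pi_pos; positivity
  have hKd : K * d = Real.pi := by rw [hd]; field_simp
  set w := z * (starRingEnd ℂ) (Complex.exp ((2 * (k : ℝ) * d : ℝ) * Complex.I)) with hw
  have hw0 : w ≠ 0 := by
    rw [hw]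
    refine mul_ne_zero hz ?_
    rw [Ne, map_eq_zero]
    exact Complex.exp_ne_zero _
  set φ := Complex.arg w with hφ
  have hn : 0 < ‖w‖ := norm_pos_iff.2 hw0
  have hwe : w = ‖w‖ * Complex.exp (φ * Complex.I) := (Complex.norm_mul_exp_arg_mul_I w).symm
  set α : ℝ := ((l : ℝ) - k) * d with hα
  have hzt : z * (starRingEnd ℂ) (Complex.exp ((2 * (l : ℝ) * d : ℝ) * Complex.I))
      = ‖w‖ * Complex.exp ((φ - 2 * α : ℝ) * Complex.I) := by
    have h1 : (starRingEnd ℂ) (Complex.exp ((2 * (l : ℝ) * d : ℝ) * Complex.I))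
      = (starRingEnd ℂ) (Complex.exp ((2 * (k : ℝ) * d : ℝ) * Complex.I))
        * Complex.exp ((- (2 * α) : ℝ) * Complex.I) := by
      rw [← Complex.exp_conj, ← Complex.exp_conj, ← Complex.exp_add]
      congr 1
      simp only [map_mul, Complex.conj_I, Complex.conj_ofReal, hα]
      push_cast
      ring
    rw [h1, ← mul_assoc, ← hw]
    conv_lhs => rw [hwe]
    rw [mul_assoc, ← Complex.exp_add]
    congr 2
    push_cast
    ring
  have hre1 : w.re = ‖w‖ * Real.cos φ := by
    conv_lhs => rw [hwe]
    rw [Complex.re_ofReal_mul, Complex.exp_ofReal_mul_I_re]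
  rw [hzt, hre1, Complex.re_ofReal_mul, Complex.exp_ofReal_mul_I_re]
  apply mul_lt_mul_of_pos_left _ hn
  have := aux_trig φ α
  suffices 0 < Real.sin α * Real.sin (α - φ) by linarith
  obtain ⟨h1, h2⟩ := harg
  have hkR : (k : ℝ) + 1 ≤ K := by exact_mod_cast hk
  have hlR : (l : ℝ) + 1 ≤ K := by exact_mod_cast hl
  have hk0 : (0 : ℝ) ≤ k := by positivity
  have hl0 : (0 : ℝ) ≤ l := by positivity
  rcases lt_or_gt_of_ne hkl with h | h
  · have h' : (l : ℝ) + 1 ≤ k := by exact_mod_cast h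
    have a1 : α ≤ -d := by rw [hα]; nlinarith
    have a2 : -(Real.pi - d) ≤ α := by rw [hα]; nlinarith
    exact mul_pos_of_neg_of_neg (Real.sin_neg_of_neg_of_neg_pi_lt (by linarith) (by linarith))
      (Real.sin_neg_of_neg_of_neg_pi_lt (by linarith) (by linarith))
  · have h' : (k : ℝ) + 1 ≤ l := by exact_mod_cast h
    have a1 : d ≤ α := by rw [hα]; nlinarith
    have a2 : α ≤ Real.pi - d := by rw [hα]; nlinarith
    exact mul_pos (Real.sin_pos_of_pos_of_lt_pi (by linarith) (by linarith))
      (Real.sin_pos_of_pos_of_lt_pi (by linarith) (by linarith))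

theorem aux_finite (K : ℕ) : (Sset K).Finite := by
  refine ((Set.finite_lt_nat K).image
    (fun k : ℕ => Complex.exp ((2 * (k : ℝ) * (Real.pi / K) : ℝ) * Complex.I))).subset ?_
  rintro s ⟨k, hk, rfl⟩
  exact ⟨k, hk, rfl⟩

theorem aux_pot {N P : ℕ} (f : ℝ → ℝ) (u : Fin P → Fin N → ℂ) (x y : Fin N → ℂ) :
    ∑ ξ, f (cOverlap u x ξ) * (cOverlap u y ξ) =
      ∑ i, (cPot f u x i * (starRingEnd ℂ) (y i)).re := by
  simp only [cPot]
  generalize hg : (fun ξ => f (cOverlap u x ξ)) = g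
  have hg' : ∀ ξ, f (cOverlap u x ξ) = g ξ := fun ξ => congrFun hg ξ
  simp only [hg', cOverlap, Finset.mul_sum, Finset.sum_mul, Complex.re_sum]
  rw [Finset.sum_comm]
  refine Finset.sum_congr rfl fun i _ => Finset.sum_congr rfl fun ξ _ => ?_
  simp
  ring

theorem aux_mem (K : ℕ) (csgn : ℂ → ℂ) (hcsgn : IsCsgn K csgn)
    {N P : ℕ} (f : ℝ → ℝ) (u : Fin P → Fin N → ℂ)
    (x : Fin N → ℂ) (hx : ∀ i, x i ∈ Sset K) (i : Fin N) : cUpd K csgn f u x i ∈ Sset K := by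
  unfold cUpd
  split_ifs with h
  · exact (hcsgn _ h).1
  · exact hx i

theorem aux_energy (K : ℕ) (hK : 1 < K) (csgn : ℂ → ℂ) (hcsgn : IsCsgn K csgn)
    {N P : ℕ} (f F : ℝ → ℝ) (hmono : Monotone f)
    (hF : ∀ t : ℝ, HasDerivAt F (f t) t) (u : Fin P → Fin N → ℂ)
    (x : Fin N → ℂ) (hx : ∀ i, x i ∈ Sset K) (hne : cUpd K csgn f u x ≠ x) :
    cEnergy F u (cUpd K csgn f u x) < cEnergy F u x := by
  have key : ∀ i, cUpd K csgn f u x i ≠ x i → (cPot f u x i * (starRingEnd ℂ) (x i)).re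
      < (cPot f u x i * (starRingEnd ℂ) (cUpd K csgn f u x i)).re := by
    intro i hi
    by_cases h : cPot f u x i ∈ Dset K
    · have e : cUpd K csgn f u x i = csgn (cPot f u x i) := by simp [cUpd, h]
      rw [e] at hi ⊢
      exact aux_max K hK _ _ _ h.1 (hcsgn _ h).1 (hx i) hi.symm (hcsgn _ h).2
    · exact absurd (by simp [cUpd, h]) hi
  have hlt : ∑ i, (cPot f u x i * (starRingEnd ℂ) (x i)).re
      < ∑ i, (cPot f u x i * (starRingEnd ℂ) (cUpd K csgn f u x i)).re := by
    apply Finset.sum_lt_sum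
    · intro i _
      by_cases h : cUpd K csgn f u x i = x i
      · rw [h]
      · exact (key i h).le
    · obtain ⟨i, hi⟩ := Function.ne_iff.1 hne
      exact ⟨i, Finset.mem_univ _, key i hi⟩
  rw [← aux_pot, ← aux_pot] at hlt
  have hle := Finset.sum_le_sum (s := Finset.univ) fun ξ _ =>
    aux_conv f F hmono hF (cOverlap u x ξ) (cOverlap u (cUpd K csgn f u x) ξ)
  simp only [mul_sub, Finset.sum_sub_distrib] at hle
  unfold cEnergy
  linarith

/-- The complex-valued multistate RCNN with synchronous update always settles at an
equilibrium. -/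
theorem complex_multistate_sync_settles (K : ℕ) (hK : 1 < K)
    (csgn : ℂ → ℂ) (hcsgn : IsCsgn K csgn)
    {N P : ℕ} (hN : 1 ≤ N) (hP : 1 ≤ P)
    (f F : ℝ → ℝ) (hf : Continuous f) (hmono : Monotone f)
    (hF : ∀ t : ℝ, HasDerivAt F (f t) t)
    (u : Fin P → Fin N → ℂ) (hu : ∀ ξ i, u ξ i ∈ Sset K)
    (x₀ : Fin N → ℂ) (hx₀ : ∀ i, x₀ i ∈ Sset K) :
    ∃ t₀ : ℕ, cUpd K csgn f u ((cUpd K csgn f u)^[t₀] x₀) = (cUpd K csgn f u)^[t₀] x₀ ∧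
      ∀ t : ℕ, t₀ ≤ t → (cUpd K csgn f u)^[t] x₀ = (cUpd K csgn f u)^[t₀] x₀ := by
  set T := cUpd K csgn f u with hT
  have hmem : ∀ t : ℕ, ∀ i, (T^[t] x₀) i ∈ Sset K := by
    intro t
    induction t with
    | zero => exact hx₀
    | succ n ih =>
      rw [Function.iterate_succ_apply']
      exact aux_mem K csgn hcsgn f u _ ih
  have hex : ∃ t₀ : ℕ, T (T^[t₀] x₀) = T^[t₀] x₀ := by
    by_contra! hcon
    have hanti : StrictAnti fun t : ℕ => cEnergy F u (T^[t] x₀) := by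
      apply strictAnti_nat_of_succ_lt
      intro n
      rw [Function.iterate_succ_apply']
      exact aux_energy K hK csgn hcsgn f F hmono hF u _ (hmem n) (hcon n)
    have hinj : Function.Injective fun t : ℕ => T^[t] x₀ := by
      intro a b hab
      exact hanti.injective (congrArg (cEnergy F u) hab)
    exact Set.infinite_of_injective_forall_mem hinj
      (s := Set.univ.pi fun _ => Sset K) (fun t i _ => hmem t i)
      (Set.Finite.pi fun _ => aux_finite K)
  obtain ⟨t₀, h⟩ := hex
  refine ⟨t₀, h, fun t ht => ?_⟩
  induction t, ht using Nat.le_induction with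
  | base => rfl
  | succ n _ ih => rw [Function.iterate_succ_apply', ih, h]
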